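/- Let k ≥ 3 be either 4 or a prime, and let 1 < a < b < c be integers with a^k < b < c such that a^k·b + 1 = r^k, a^k·c + 1 = s^k, and b·c + 1 = t^k for positive integers r, s, t. With N := a^k·b, μ_k := Π_{p prime, p ∣ k} p^{1/(p−1)}, and λ := 1 + log(k·μ_k·(√N + √(N+1))^2) / log((1/(k·μ_k))·(√N + √(N+1))^2), one has (a^2·t)^{k−λ} < 8·μ_k·(a^k·b)^2, where real exponents denote real powers and log is the natural logarithm. -/

import Mathlib

open Polynomial in
/-- Real version of the shifted Legendre polynomial. -/
noncomputable def bnLeg (n : ℕ) : Polynomial ℝ := (Polynomial.shiftedLegendre n).map (Int.castRingHom ℝ)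

open Polynomial in
theorem bnLeg_rodrigues (n : ℕ) :
    (C (n.factorial : ℝ)) * bnLeg n = derivative^[n] (X ^ n * (1 - (X : ℝ[X])) ^ n) := by
  have h := congrArg (Polynomial.map (Int.castRingHom ℝ)) (factorial_mul_shiftedLegendre_eq n)
  rw [← Polynomial.iterate_derivative_map] at h
  simpa [bnLeg] using h

open Polynomial in
theorem bnLeg_coeff (n j : ℕ) :
    (bnLeg n).coeff j = (-1) ^ j * n.choose j * (n + j).choose n := by
  simp [bnLeg, coeff_shiftedLegendre]

open Polynomial in
theorem bnLeg_symm (n : ℕ) : bnLeg n = (-1) ^ n * (bnLeg n).comp (1 - X) := by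
  have h := congrArg (Polynomial.map (Int.castRingHom ℝ))
    (neg_one_pow_mul_shiftedLegendre_comp_one_sub_X_eq n)
  rw [Polynomial.map_mul, Polynomial.map_comp] at h
  simpa [bnLeg] using h.symm

open Polynomial in
theorem bnLeg_der_zero (n j : ℕ) :
    (derivative^[j] (bnLeg n)).eval 0 = (-1) ^ j * j.factorial * n.choose j * (n + j).choose n := by
  rw [← coeff_zero_eq_eval_zero, coeff_iterate_derivative, zero_add, bnLeg_coeff,
    Nat.descFactorial_self, nsmul_eq_mul]
  ring

open Polynomial in
theorem bnLeg_der_one (n j : ℕ) :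
    (derivative^[j] (bnLeg n)).eval 1 = (-1) ^ n * (j.factorial * n.choose j * (n + j).choose n) := by
  have e : bnLeg n = C ((-1 : ℝ) ^ n) * (bnLeg n).comp (1 - X) := by
    conv_lhs => rw [bnLeg_symm]
    simp
  rw [e, iterate_derivative_C_mul, iterate_derivative_comp_one_sub_X]
  simp only [eval_mul, eval_C, eval_pow, eval_neg, eval_one, eval_comp, eval_sub, eval_X, sub_self,
    bnLeg_der_zero]
  have : ((-1 : ℝ) ^ j) * (-1) ^ j = 1 := by rw [← mul_pow]; simp
  linear_combination (-1 : ℝ) ^ n * (j.factorial * n.choose j * (n + j).choose n) * this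

open Polynomial in
theorem bnLeg_der_top (n : ℕ) : derivative^[n + 1] (bnLeg n) = 0 := by
  apply iterate_derivative_eq_zero
  have := natDegree_map_le (f := Int.castRingHom ℝ) (p := shiftedLegendre n)
  rw [natDegree_shiftedLegendre] at this
  unfold bnLeg; omega

open Polynomial in
theorem bnLeg_eval_neg (n : ℕ) (x : ℝ) :
    ∑ j ∈ Finset.range (n + 1), (n.choose j : ℝ) * (n + j).choose n * x ^ j =
      (bnLeg n).eval (-x) := by
  simp only [bnLeg, shiftedLegendre, Polynomial.map_sum, eval_finsetSum]
  apply Finset.sum_congr rfl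
  intro j _
  have : ((-1 : ℝ) ^ j) * (-1) ^ j = 1 := by rw [← mul_pow]; simp
  simp [neg_pow x]
  linear_combination - (n.choose j : ℝ) * (n + j).choose n * x ^ j * this

open Polynomial in
theorem bnLeg_squares (n : ℕ) (x : ℝ) :
    ∑ j ∈ Finset.range (n + 1), (n.choose j : ℝ) * (n + j).choose n * x ^ j =
      ∑ j ∈ Finset.range (n + 1), (n.choose j : ℝ) ^ 2 * (x ^ j * (1 + x) ^ (n - j)) := by
  rw [bnLeg_eval_neg]
  have hf : (n.factorial : ℝ) ≠ 0 := by positivity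
  apply mul_left_cancel₀ hf
  have h := congrArg (Polynomial.eval (-x)) (bnLeg_rodrigues n)
  rw [eval_mul, eval_C] at h
  rw [h, iterate_derivative_mul, eval_finsetSum, Finset.mul_sum]
  apply Finset.sum_congr rfl
  intro j hj
  have hj' : j ≤ n := by simpa [Nat.lt_succ_iff] using hj
  have e : (1 - X : ℝ[X]) ^ n = (X ^ n).comp (1 - X) := by simp
  rw [e, iterate_derivative_comp_one_sub_X, iterate_derivative_X_pow_eq_C_mul,
    iterate_derivative_X_pow_eq_C_mul]
  have e1 : n - (n - j) = j := by omega
  have : ((-1 : ℝ) ^ j) * (-1) ^ j = 1 := by rw [← mul_pow]; simp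
  have c1 : ((n.descFactorial j : ℕ) : ℝ) = j.factorial * n.choose j := by
    rw [Nat.descFactorial_eq_factorial_mul_choose]; push_cast; ring
  have c2 : ((n.descFactorial (n - j) : ℕ) : ℝ) = (n - j).factorial * n.choose j := by
    rw [Nat.descFactorial_eq_factorial_mul_choose, Nat.choose_symm hj']; push_cast; ring
  have c3 : (n.choose j : ℝ) * j.factorial * (n - j).factorial = n.factorial := by
    exact_mod_cast Nat.choose_mul_factorial_mul_factorial hj'
  simp [e1, neg_pow x, c1, c2]
  rw [← c3]
  linear_combination (n.choose j : ℝ) ^ 3 * j.factorial * (n - j).factorial * x ^ j * (1 + x) ^ (n - j) * this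

theorem bnLeg_bound (n : ℕ) (x : ℝ) (hx : 0 ≤ x) :
    ∑ j ∈ Finset.range (n + 1), (n.choose j : ℝ) * (n + j).choose n * x ^ j ≤
      ((Real.sqrt x + Real.sqrt (x + 1)) ^ 2) ^ n := by
  rw [bnLeg_squares, ← pow_mul, mul_comm 2 n, pow_mul, add_pow]
  refine le_trans (le_of_eq ?_) (Finset.sum_sq_le_sq_sum_of_nonneg (fun i _ => by positivity))
  apply Finset.sum_congr rfl
  intro j _
  rw [mul_pow, mul_pow, ← pow_mul, ← pow_mul, mul_comm j 2, mul_comm (n - j) 2, pow_mul, pow_mul,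
    Real.sq_sqrt hx, Real.sq_sqrt (by linarith), add_comm x 1]
  ring

/-- Weights of the iterated antiderivative. -/
noncomputable def bnW (m : ℝ) (j : ℕ) : ℝ := (-1) ^ j / ∏ l ∈ Finset.range (j + 1), ((l : ℝ) - m)

theorem bn_factor_ne (m : ℝ) (h0 : 0 < m) (h1 : m < 1) (l : ℕ) : (l : ℝ) - m ≠ 0 := by
  rcases Nat.eq_zero_or_pos l with rfl | h
  · simp; linarith
  · have : (1 : ℝ) ≤ l := by exact_mod_cast h
    intro h; linarith

theorem bnW_succ (m : ℝ) (h0 : 0 < m) (h1 : m < 1) (j : ℕ) :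
    bnW m (j + 1) * ((j : ℝ) + 1 - m) = - bnW m j := by
  unfold bnW
  rw [Finset.prod_range_succ _ (j + 1)]
  have a := bn_factor_ne m h0 h1 (j + 1)
  have b : ∏ l ∈ Finset.range (j + 1), ((l : ℝ) - m) ≠ 0 :=
    Finset.prod_ne_zero_iff.2 fun l _ => bn_factor_ne m h0 h1 l
  push_cast at a ⊢
  field_simp
  ring

open Polynomial in
theorem bn_antideriv (m x : ℝ) (h0 : 0 < m) (h1 : m < 1) (P : ℝ[X]) (n : ℕ) (t : ℝ)
    (ht : 0 < x + t) :
    HasDerivAt (fun t : ℝ => ∑ j ∈ Finset.range (n + 1),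
      (derivative^[j] P).eval t * (x + t) ^ ((j : ℝ) - m) * bnW m j)
      (P.eval t * (x + t) ^ (-m - 1) +
        (derivative^[n + 1] P).eval t * (x + t) ^ ((n : ℝ) - m) * bnW m n) t := by
  have key : ∀ j : ℕ, HasDerivAt (fun t : ℝ =>
      (derivative^[j] P).eval t * (x + t) ^ ((j : ℝ) - m) * bnW m j)
      (((derivative^[j + 1] P).eval t * (x + t) ^ ((j : ℝ) - m) +
        (derivative^[j] P).eval t * (((j : ℝ) - m) * (x + t) ^ ((j : ℝ) - m - 1))) * bnW m j) t := by
    intro j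
    have a := (derivative^[j] P).hasDerivAt t
    rw [← Function.iterate_succ_apply' derivative] at a
    have b : HasDerivAt (fun t : ℝ => (x + t) ^ ((j : ℝ) - m))
        (((j : ℝ) - m) * (x + t) ^ ((j : ℝ) - m - 1)) t := by
      have := ((hasDerivAt_id t).const_add x).rpow_const (p := (j : ℝ) - m) (Or.inl ht.ne')
      simpa using this
    exact (a.mul b).mul_const _
  induction n with
  | zero =>
    have := key 0
    simp only [zero_add, Finset.sum_range_one]
    refine this.congr_deriv ?_
    have hw : bnW m 0 * (-m) = 1 := by
      unfold bnW; simp; field_simp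
    simp only [Nat.cast_zero, zero_sub, Function.iterate_zero, id]
    linear_combination P.eval t * (x + t) ^ (-m - 1) * hw
  | succ n ih =>
    have := ih.add (key (n + 1))
    simp only [Finset.sum_range_succ _ (n + 1)]
    refine this.congr_deriv ?_
    have hw := bnW_succ m h0 h1 n
    have e : ((n + 1 : ℕ) : ℝ) - m - 1 = n - m := by push_cast; ring
    rw [e]
    push_cast
    linear_combination (derivative^[n + 1] P).eval t * (x + t) ^ ((n : ℝ) - m) * hw

theorem bn_rpow_cont (x e : ℝ) (hx : 0 < x) :
    ContinuousOn (fun t : ℝ => (x + t) ^ e) (Set.Icc 0 1) := by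
  intro t ht
  have : 0 < x + t := by linarith [ht.1]
  exact (ContinuousAt.rpow_const (by fun_prop) (Or.inl this.ne')).continuousWithinAt

open Polynomial in
theorem bn_poly_int (x e : ℝ) (hx : 0 < x) (P : ℝ[X]) :
    IntervalIntegrable (fun t : ℝ => P.eval t * (x + t) ^ e) MeasureTheory.volume 0 1 := by
  apply ContinuousOn.intervalIntegrable
  rw [Set.uIcc_of_le zero_le_one]
  exact P.continuous.continuousOn.mul (bn_rpow_cont x e hx)

open Polynomial in
theorem bn_int_leg (m x : ℝ) (h0 : 0 < m) (h1 : m < 1) (hx : 0 < x) (n : ℕ) :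
    ∫ t in (0 : ℝ)..1, (bnLeg n).eval t * (x + t) ^ (-m - 1) =
      (∑ j ∈ Finset.range (n + 1),
        (-1) ^ n * (j.factorial * n.choose j * (n + j).choose n) * (x + 1) ^ ((j : ℝ) - m) * bnW m j)
      - ∑ j ∈ Finset.range (n + 1),
        (-1) ^ j * j.factorial * n.choose j * (n + j).choose n * x ^ ((j : ℝ) - m) * bnW m j := by
  rw [intervalIntegral.integral_eq_sub_of_hasDerivAt (f := fun t : ℝ => ∑ j ∈ Finset.range (n + 1),
      (derivative^[j] (bnLeg n)).eval t * (x + t) ^ ((j : ℝ) - m) * bnW m j) _ (bn_poly_int _ _ hx _)]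
  · simp only [bnLeg_der_one, bnLeg_der_zero, add_zero]
  · intro t ht
    rw [Set.uIcc_of_le zero_le_one] at ht
    have := bn_antideriv m x h0 h1 (bnLeg n) n t (by linarith [ht.1])
    simpa [bnLeg_der_top] using this

open Polynomial in
theorem bn_parts (x e : ℝ) (hx : 0 < x) (P : ℝ[X]) (hP0 : P.eval 0 = 0) (hP1 : P.eval 1 = 0) :
    ∫ t in (0 : ℝ)..1, (derivative P).eval t * (x + t) ^ e =
      ∫ t in (0 : ℝ)..1, (-e) * (P.eval t * (x + t) ^ (e - 1)) := by
  have h := intervalIntegral.integral_eq_sub_of_hasDerivAt (a := 0) (b := 1)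
    (f := fun t : ℝ => P.eval t * (x + t) ^ e)
    (f' := fun t : ℝ => (derivative P).eval t * (x + t) ^ e - (-e) * (P.eval t * (x + t) ^ (e - 1)))
    (by
      intro t ht
      rw [Set.uIcc_of_le zero_le_one] at ht
      have hp : 0 < x + t := by linarith [ht.1]
      have b : HasDerivAt (fun t : ℝ => (x + t) ^ e) (e * (x + t) ^ (e - 1)) t := by
        have := ((hasDerivAt_id t).const_add x).rpow_const (p := e) (Or.inl hp.ne')
        simpa using this
      refine ((P.hasDerivAt t).mul b).congr_deriv ?_
      ring)
    ((bn_poly_int _ _ hx _).sub ((bn_poly_int _ _ hx _).const_mul _))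
  rw [intervalIntegral.integral_sub (bn_poly_int _ _ hx _) ((bn_poly_int _ _ hx _).const_mul _)] at h
  simp only [hP0, hP1, zero_mul, sub_zero] at h
  linarith

open Polynomial in
theorem bn_parts_iter (m x : ℝ) (hx : 0 < x) (n i : ℕ) (hi : i ≤ n) :
    ∫ t in (0 : ℝ)..1, (derivative^[n] (X ^ n * (1 - (X : ℝ[X])) ^ n)).eval t * (x + t) ^ (-m - 1) =
      (∏ l ∈ Finset.range i, (m + 1 + l)) *
      ∫ t in (0 : ℝ)..1, (derivative^[n - i] (X ^ n * (1 - (X : ℝ[X])) ^ n)).eval t *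
        (x + t) ^ (-m - 1 - i) := by
  induction i with
  | zero => simp
  | succ i ih =>
    rw [ih (by omega)]
    have e : n - i = (n - (i + 1)) + 1 := by omega
    have v0 : (derivative^[n - (i + 1)] (X ^ n * (1 - (X : ℝ[X])) ^ n)).eval 0 = 0 := by
      have := pow_sub_dvd_iterate_derivative_of_pow_dvd (p := X ^ n * (1 - (X : ℝ[X])) ^ n)
        (q := X) (n := n) (n - (i + 1)) (dvd_mul_right _ _)
      obtain ⟨g, hg⟩ := this
      rw [hg, eval_mul, eval_pow, eval_X, zero_pow (by omega), zero_mul]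
    have v1 : (derivative^[n - (i + 1)] (X ^ n * (1 - (X : ℝ[X])) ^ n)).eval 1 = 0 := by
      have := pow_sub_dvd_iterate_derivative_of_pow_dvd (p := X ^ n * (1 - (X : ℝ[X])) ^ n)
        (q := 1 - X) (n := n) (n - (i + 1)) (dvd_mul_left _ _)
      obtain ⟨g, hg⟩ := this
      rw [hg, eval_mul, eval_pow, eval_sub, eval_X, eval_one, sub_self, zero_pow (by omega), zero_mul]
    rw [e, Function.iterate_succ_apply', bn_parts x _ hx _ v0 v1, intervalIntegral.integral_const_mul,
      Finset.prod_range_succ]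
    have e2 : -m - 1 - (i : ℝ) - 1 = -m - 1 - ((i + 1 : ℕ) : ℝ) := by push_cast; ring
    rw [e2]
    ring

open Polynomial in
theorem bn_int_leg2 (m x : ℝ) (hx : 0 < x) (n : ℕ) :
    (n.factorial : ℝ) * ∫ t in (0 : ℝ)..1, (bnLeg n).eval t * (x + t) ^ (-m - 1) =
      (∏ l ∈ Finset.range n, (m + 1 + l)) *
      ∫ t in (0 : ℝ)..1, (t ^ n * (1 - t) ^ n) * (x + t) ^ (-m - 1 - n) := by
  have h := bn_parts_iter m x hx n n le_rfl
  rw [← bnLeg_rodrigues] at h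
  simp only [eval_mul, eval_C, mul_assoc, Nat.sub_self, Function.iterate_zero, id, eval_pow,
    eval_X, eval_sub, eval_one] at h
  rw [intervalIntegral.integral_const_mul] at h
  rw [h]
  simp only [mul_assoc]


/-- Coefficients of the Padé approximants. -/
noncomputable def bnC (m : ℝ) (n j : ℕ) : ℝ :=
  (n + j).choose n * ((∏ l ∈ Finset.range (n - j), ((n : ℝ) - l - m)) / (n - j).factorial)

theorem bn_prod_split (m : ℝ) (n i : ℕ) (hi : i ≤ n) :
    ∏ l ∈ Finset.range (n + 1), ((l : ℝ) - m) =
      (∏ l ∈ Finset.range (n - i + 1), ((l : ℝ) - m)) * ∏ l ∈ Finset.range i, ((n : ℝ) - l - m) := by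
  induction i with
  | zero => simp
  | succ i ih =>
    rw [ih (by omega), Finset.prod_range_succ _ i]
    have e : n - i = (n - (i + 1)) + 1 := by omega
    rw [e, Finset.prod_range_succ _ (n - (i + 1) + 1)]
    have : ((n - (i + 1) + 1 : ℕ) : ℝ) = (n : ℝ) - i := by
      rw [← e, Nat.cast_sub (by omega)]
    rw [this]
    ring

theorem bnC_eq (m : ℝ) (h0 : 0 < m) (h1 : m < 1) (n j : ℕ) (hj : j ≤ n) :
    (∏ l ∈ Finset.range (n + 1), ((l : ℝ) - m)) / n.factorial *
      ((-1) ^ j * j.factorial * n.choose j * (n + j).choose n * bnW m j) = bnC m n j := by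
  have e : n - (n - j) = j := by omega
  rw [bn_prod_split m n (n - j) (by omega), e]
  unfold bnC bnW
  have b : ∏ l ∈ Finset.range (j + 1), ((l : ℝ) - m) ≠ 0 :=
    Finset.prod_ne_zero_iff.2 fun l _ => bn_factor_ne m h0 h1 l
  have c3 : (n.choose j : ℝ) * j.factorial * (n - j).factorial = n.factorial := by
    exact_mod_cast Nat.choose_mul_factorial_mul_factorial hj
  have hs : ((-1 : ℝ) ^ j) * (-1) ^ j = 1 := by rw [← mul_pow]; simp
  have f1 : (n.factorial : ℝ) ≠ 0 := by positivity
  have f2 : ((n - j).factorial : ℝ) ≠ 0 := by positivity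
  generalize (∏ l ∈ Finset.range (n - j), ((n : ℝ) - l - m)) = P
  generalize (∏ l ∈ Finset.range (j + 1), ((l : ℝ) - m)) = R at b ⊢
  rw [← c3] at f1 ⊢
  have f3 : (n.choose j : ℝ) ≠ 0 := fun h => f1 (by rw [h]; ring)
  have f4 : (j.factorial : ℝ) ≠ 0 := by positivity
  field_simp
  linear_combination P * ((n + j).choose n : ℝ) * hs

/-- The two Padé values. -/
noncomputable def bnA (m : ℝ) (n : ℕ) (x : ℝ) : ℝ := ∑ j ∈ Finset.range (n + 1), bnC m n j * x ^ j
noncomputable def bnB (m : ℝ) (n : ℕ) (x : ℝ) : ℝ :=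
  ∑ j ∈ Finset.range (n + 1), (-1) ^ (n + j) * (bnC m n j * (x + 1) ^ j)

theorem bn_identity (m x : ℝ) (h0 : 0 < m) (h1 : m < 1) (hx : 0 < x) (n : ℕ) :
    x ^ (-m) * bnA m n x - (x + 1) ^ (-m) * bnB m n x =
      -((∏ l ∈ Finset.range (n + 1), ((l : ℝ) - m)) / n.factorial) *
        ∫ t in (0 : ℝ)..1, (bnLeg n).eval t * (x + t) ^ (-m - 1) := by
  rw [bn_int_leg m x h0 h1 hx, mul_sub, Finset.mul_sum, Finset.mul_sum]
  have hA : x ^ (-m) * bnA m n x = - ∑ j ∈ Finset.range (n + 1),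
      -((∏ l ∈ Finset.range (n + 1), ((l : ℝ) - m)) / n.factorial) *
      ((-1) ^ j * j.factorial * n.choose j * (n + j).choose n * x ^ ((j : ℝ) - m) * bnW m j) := by
    rw [bnA, Finset.mul_sum, ← Finset.sum_neg_distrib]
    apply Finset.sum_congr rfl
    intro j hj
    have hj' : j ≤ n := by simpa [Nat.lt_succ_iff] using hj
    rw [← bnC_eq m h0 h1 n j hj']
    have : x ^ ((j : ℝ) - m) = x ^ (-m) * x ^ j := by
      rw [← Real.rpow_natCast x j, ← Real.rpow_add hx]; congr 1; ring
    rw [this]; ring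
  have hB : (x + 1) ^ (-m) * bnB m n x = - ∑ j ∈ Finset.range (n + 1),
      -((∏ l ∈ Finset.range (n + 1), ((l : ℝ) - m)) / n.factorial) *
      ((-1) ^ n * (j.factorial * n.choose j * (n + j).choose n) * (x + 1) ^ ((j : ℝ) - m) * bnW m j) := by
    rw [bnB, Finset.mul_sum, ← Finset.sum_neg_distrib]
    apply Finset.sum_congr rfl
    intro j hj
    have hj' : j ≤ n := by simpa [Nat.lt_succ_iff] using hj
    rw [← bnC_eq m h0 h1 n j hj']
    have : (x + 1) ^ ((j : ℝ) - m) = (x + 1) ^ (-m) * (x + 1) ^ j := by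
      rw [← Real.rpow_natCast (x + 1) j, ← Real.rpow_add (by linarith)]; congr 1; ring
    have hs : ((-1 : ℝ) ^ j) * (-1) ^ j = 1 := by rw [← mul_pow]; simp
    rw [this, pow_add]
    linear_combination (x + 1) ^ (-m) * (-1) ^ n * ((∏ l ∈ Finset.range (n + 1), ((l : ℝ) - m)) / n.factorial *
      (j.factorial * n.choose j * (n + j).choose n * bnW m j) * (x + 1) ^ j) * hs
  rw [hA, hB]; ring

theorem bn_rho (x t : ℝ) (hx : 0 < x) (ht : 0 ≤ t) :
    t * (1 - t) * (Real.sqrt x + Real.sqrt (x + 1)) ^ 2 ≤ x + t := by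
  have hu := Real.sq_sqrt hx.le
  have hv := Real.sq_sqrt (show (0 : ℝ) ≤ x + 1 by linarith)
  have pu := Real.sqrt_nonneg x
  have pv := Real.sqrt_nonneg (x + 1)
  set u := Real.sqrt x
  set v := Real.sqrt (x + 1)
  have h1 : t * (1 - t) ≤ (v - u) ^ 2 * (x + t) := by
    nlinarith [sq_nonneg (x + t - u * v)]
  have h2 : (v - u) * (u + v) = 1 := by nlinarith
  calc t * (1 - t) * (u + v) ^ 2 ≤ (v - u) ^ 2 * (x + t) * (u + v) ^ 2 := by gcongr
    _ = ((v - u) * (u + v)) ^ 2 * (x + t) := by ring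
    _ = x + t := by rw [h2]; ring

theorem bn_J_pos (m x : ℝ) (hx : 0 < x) (n : ℕ) :
    0 < ∫ t in (0 : ℝ)..1, (t ^ n * (1 - t) ^ n) * (x + t) ^ (-m - 1 - n) := by
  apply intervalIntegral.intervalIntegral_pos_of_pos_on _ _ zero_lt_one
  · apply ContinuousOn.intervalIntegrable
    rw [Set.uIcc_of_le zero_le_one]
    exact ContinuousOn.mul (by fun_prop) (bn_rpow_cont x _ hx)
  · intro t ht
    have h1 := ht.1
    have h2 : 0 < 1 - t := by linarith [ht.2]
    have h3 : 0 < x + t := by linarith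
    positivity

theorem bn_J_le (m x : ℝ) (h0 : 0 < m) (hx : 0 < x) (n : ℕ) :
    ∫ t in (0 : ℝ)..1, (t ^ n * (1 - t) ^ n) * (x + t) ^ (-m - 1 - n) ≤
      x ^ (-m - 1) / ((Real.sqrt x + Real.sqrt (x + 1)) ^ 2) ^ n := by
  set Q := (Real.sqrt x + Real.sqrt (x + 1)) ^ 2 with hQ
  have hQp : 0 < Q := by have := Real.sqrt_pos.2 hx; positivity
  have : ∫ t in (0 : ℝ)..1, (t ^ n * (1 - t) ^ n) * (x + t) ^ (-m - 1 - n) ≤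
      ∫ t in (0 : ℝ)..1, x ^ (-m - 1) / Q ^ n := by
    apply intervalIntegral.integral_mono_on zero_le_one
    · apply ContinuousOn.intervalIntegrable
      rw [Set.uIcc_of_le zero_le_one]
      exact ContinuousOn.mul (by fun_prop) (bn_rpow_cont x _ hx)
    · simp
    · intro t ht
      have h1 := ht.1
      have h2 : 0 ≤ 1 - t := by linarith [ht.2]
      have h3 : 0 < x + t := by linarith
      have e : (x + t) ^ (-m - 1 - n) = (x + t) ^ (-m - 1) / (x + t) ^ n := by
        rw [Real.rpow_sub h3, Real.rpow_natCast]
      have g : (x + t) ^ (-m - 1) ≤ x ^ (-m - 1) :=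
        Real.rpow_le_rpow_of_nonpos hx (by linarith) (by linarith)
      have g2 : (t * (1 - t)) ^ n * Q ^ n ≤ (x + t) ^ n := by
        rw [← mul_pow]
        exact pow_le_pow_left₀ (by positivity) (bn_rho x t hx h1) n
      rw [e, ← mul_pow, le_div_iff₀ (by positivity)]
      have g3 : (t * (1 - t)) ^ n * Q ^ n / (x + t) ^ n ≤ 1 := by
        rw [div_le_one (by positivity)]; exact g2
      calc (t * (1 - t)) ^ n * ((x + t) ^ (-m - 1) / (x + t) ^ n) * Q ^ n
          = (x + t) ^ (-m - 1) * ((t * (1 - t)) ^ n * Q ^ n / (x + t) ^ n) := by ring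
        _ ≤ (x + t) ^ (-m - 1) * 1 := by gcongr
        _ ≤ x ^ (-m - 1) := by linarith
  simpa using this

theorem bn_const (m : ℝ) (h0 : 0 < m) (h1 : m < 1) (n : ℕ) :
    ∃ K : ℝ, 0 < K ∧ K ≤ m ∧
    -((∏ l ∈ Finset.range (n + 1), ((l : ℝ) - m)) / n.factorial) *
      ((∏ l ∈ Finset.range n, (m + 1 + l)) / n.factorial) = K := by
  refine ⟨m * ∏ l ∈ Finset.range n, (((l : ℝ) + 1 - m) * (m + 1 + l) / ((l + 1) * (l + 1))), ?_, ?_, ?_⟩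
  · apply mul_pos h0
    apply Finset.prod_pos
    intro l _
    have : 0 < (l : ℝ) + 1 - m := by have : (0 : ℝ) ≤ l := by positivity
                                     linarith
    positivity
  · have : ∏ l ∈ Finset.range n, (((l : ℝ) + 1 - m) * (m + 1 + l) / ((l + 1) * (l + 1))) ≤ 1 := by
      apply Finset.prod_le_one
      · intro l _
        have : 0 < (l : ℝ) + 1 - m := by have : (0 : ℝ) ≤ l := by positivity
                                         linarith
        positivity
      · intro l _
        rw [div_le_one (by positivity)]
        nlinarith
    nlinarith
  · rw [Finset.prod_range_succ', Finset.prod_div_distrib, Finset.prod_mul_distrib,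
      Finset.prod_mul_distrib]
    have : (n.factorial : ℝ) = ∏ l ∈ Finset.range n, ((l : ℝ) + 1) := by
      rw [← Finset.prod_range_add_one_eq_factorial]; push_cast; rfl
    rw [← this]
    push_cast
    have f1 : (n.factorial : ℝ) ≠ 0 := by positivity
    field_simp
    ring

theorem bn_remainder (m x : ℝ) (h0 : 0 < m) (h1 : m < 1) (hx : 0 < x) (n : ℕ) :
    0 < x ^ (-m) * bnA m n x - (x + 1) ^ (-m) * bnB m n x ∧
    x ^ (-m) * bnA m n x - (x + 1) ^ (-m) * bnB m n x ≤
      m * (x ^ (-m - 1) / ((Real.sqrt x + Real.sqrt (x + 1)) ^ 2) ^ n) := by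
  rw [bn_identity m x h0 h1 hx]
  obtain ⟨K, k0, k1, hK⟩ := bn_const m h0 h1 n
  have h2 := bn_int_leg2 m x hx n
  have f1 : (n.factorial : ℝ) ≠ 0 := by positivity
  have e : -((∏ l ∈ Finset.range (n + 1), ((l : ℝ) - m)) / n.factorial) *
        ∫ t in (0 : ℝ)..1, (bnLeg n).eval t * (x + t) ^ (-m - 1) =
      K * ∫ t in (0 : ℝ)..1, (t ^ n * (1 - t) ^ n) * (x + t) ^ (-m - 1 - n) := by
    rw [← hK, mul_assoc, div_mul_eq_mul_div _ _ (∫ t in (0 : ℝ)..1, (t ^ n * (1 - t) ^ n) * (x + t) ^ (-m - 1 - n)),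
      ← h2]
    field_simp
  rw [e]
  have p := bn_J_pos m x hx n
  exact ⟨mul_pos k0 p, mul_le_mul k1 (bn_J_le m x h0 hx n) p.le h0.le⟩

theorem bn_prod_choose (n i : ℕ) (hi : i ≤ n) :
    ∏ l ∈ Finset.range i, ((n : ℝ) - l) = i.factorial * n.choose i := by
  have : (n.descFactorial i : ℝ) = ∏ l ∈ Finset.range i, ((n : ℝ) - l) := by
    rw [Nat.descFactorial_eq_prod_range]
    push_cast
    apply Finset.prod_congr rfl
    intro l hl
    have := Finset.mem_range.1 hl
    rw [Nat.cast_sub (by omega)]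
  rw [← this, Nat.descFactorial_eq_factorial_mul_choose]; push_cast; rfl

theorem bnC_bounds (m : ℝ) (h0 : 0 < m) (h1 : m < 1) (n j : ℕ) (hj : j ≤ n) :
    0 < bnC m n j ∧ bnC m n j ≤ n.choose j * (n + j).choose n := by
  have hpos : ∀ l ∈ Finset.range (n - j), 0 < (n : ℝ) - l - m := by
    intro l hl
    have := Finset.mem_range.1 hl
    have : ((l + 1 : ℕ) : ℝ) ≤ n := by exact_mod_cast (by omega)
    push_cast at this
    linarith
  have hc : 0 < (n + j).choose n := Nat.choose_pos (by omega)
  unfold bnC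
  constructor
  · have := Finset.prod_pos hpos
    positivity
  · have h := bn_prod_choose n (n - j) (by omega)
    rw [Nat.choose_symm hj] at h
    have : ∏ l ∈ Finset.range (n - j), ((n : ℝ) - l - m) ≤ ∏ l ∈ Finset.range (n - j), ((n : ℝ) - l) :=
      Finset.prod_le_prod (fun l hl => (hpos l hl).le) (fun l hl => by linarith)
    rw [h] at this
    rw [mul_comm]
    gcongr
    rw [div_le_iff₀ (by positivity)]
    linarith

theorem bnA_bounds (m x : ℝ) (h0 : 0 < m) (h1 : m < 1) (hx : 0 < x) (n : ℕ) :
    0 < bnA m n x ∧ bnA m n x ≤ ((Real.sqrt x + Real.sqrt (x + 1)) ^ 2) ^ n := by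
  constructor
  · apply Finset.sum_pos
    · intro j hj
      have hj' : j ≤ n := by simpa [Nat.lt_succ_iff] using hj
      have := (bnC_bounds m h0 h1 n j hj').1
      positivity
    · simp
  · refine le_trans ?_ (bnLeg_bound n x hx.le)
    apply Finset.sum_le_sum
    intro j hj
    have hj' : j ≤ n := by simpa [Nat.lt_succ_iff] using hj
    have := (bnC_bounds m h0 h1 n j hj').2
    gcongr


theorem bn_dvd_prod (k : ℤ) (w i n : ℕ) (hw : IsCoprime k (w : ℤ)) (hi : w ∣ i.factorial) :
    (w : ℤ) ∣ ∏ l ∈ Finset.range i, (k * ((n : ℤ) - l) - 1) := by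
  obtain ⟨u, v, huv⟩ := hw
  have h1 : ((i.factorial : ℕ) : ℤ) ∣ ∏ l ∈ Finset.range i, ((n : ℤ) - u - l) := by
    have := Ring.descPochhammer_eq_factorial_smul_choose ((n : ℤ) - u) i
    rw [← Polynomial.eval_eq_smeval, descPochhammer_eval_eq_prod_range] at this
    rw [this, nsmul_eq_mul]
    exact dvd_mul_right _ _
  have h2 : (w : ℤ) ∣ ∏ l ∈ Finset.range i, ((n : ℤ) - u - l) :=
    dvd_trans (by exact_mod_cast hi) h1
  have h3 : (w : ℤ) ∣ k ^ i * ∏ l ∈ Finset.range i, ((n : ℤ) - u - l) := dvd_mul_of_dvd_right h2 _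
  have e : k ^ i * ∏ l ∈ Finset.range i, ((n : ℤ) - u - l) =
      ∏ l ∈ Finset.range i, (k * ((n : ℤ) - u - l)) := by
    rw [Finset.prod_mul_distrib]; simp
  rw [e] at h3
  rw [← ZMod.intCast_zmod_eq_zero_iff_dvd] at h3 ⊢ 
  rw [← h3]
  have huv' := congrArg (Int.cast : ℤ → ZMod w) huv
  push_cast at huv' ⊢
  simp only [ZMod.natCast_self, mul_zero, add_zero] at huv'
  apply Finset.prod_congr rfl
  intro l _
  linear_combination huv'

theorem bn_fact_split (p : ℕ) (hp : p.Prime) (i : ℕ) :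
    ∃ v w : ℕ, i.factorial = p ^ v * w ∧ Nat.Coprime p w ∧ (p - 1) * v ≤ i := by
  have := Fact.mk hp
  refine ⟨i.factorial.factorization p, i.factorial / p ^ i.factorial.factorization p,
    (Nat.ordProj_mul_ordCompl_eq_self _ p).symm, Nat.coprime_ordCompl hp (Nat.factorial_ne_zero i), ?_⟩
  rw [Nat.factorization_def _ hp, sub_one_mul_padicValNat_factorial]
  exact Nat.sub_le _ _

theorem bn_denoms (k : ℕ) (hk : 3 ≤ k) (hk4 : k = 4 ∨ Nat.Prime k) (n : ℕ) :
    ∃ D : ℕ, 0 < D ∧ (D : ℝ) ≤ ((k : ℝ) * ∏ l ∈ k.primeFactors, (l : ℝ) ^ ((1 : ℝ) / ((l : ℝ) - 1))) ^ n ∧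
      ∀ i ≤ n, ((k ^ i * i.factorial : ℕ) : ℤ) ∣ D * ∏ l ∈ Finset.range i, ((k : ℤ) * ((n : ℤ) - l) - 1) := by
  rcases hk4 with rfl | hp
  · refine ⟨8 ^ n, by positivity, ?_, ?_⟩
    · have : Nat.primeFactors 4 = {2} := by
        rw [show 4 = 2 ^ 2 by norm_num, Nat.primeFactors_prime_pow (by norm_num) Nat.prime_two]
      rw [this]; norm_num
    · intro i hi
      obtain ⟨v, w, h, hc, hv⟩ := bn_fact_split 2 Nat.prime_two i
      have hd := bn_dvd_prod 4 w i n (by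
        have : Nat.Coprime 4 w := by
          rw [show 4 = 2 ^ 2 by norm_num]; exact hc.pow_left 2
        exact_mod_cast Nat.isCoprime_iff_coprime.2 this) ⟨2 ^ v, by rw [h, mul_comm]⟩
      rw [h, ← mul_assoc]
      push_cast
      refine mul_dvd_mul ?_ hd
      rw [show (4 : ℤ) = 2 ^ 2 by norm_num, show (8 : ℤ) = 2 ^ 3 by norm_num, ← pow_mul, ← pow_mul, ← pow_add]
      exact pow_dvd_pow _ (by omega)
  · refine ⟨k ^ (n + n / (k - 1)), pow_pos hp.pos _, ?_, ?_⟩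
    · rw [hp.primeFactors, Finset.prod_singleton, mul_pow, ← Real.rpow_natCast (_ ^ _) n,
        ← Real.rpow_mul (by positivity)]
      push_cast
      rw [pow_add, ← Real.rpow_natCast _ (n / (k - 1))]
      have k1 : (1 : ℝ) ≤ k := by exact_mod_cast hp.one_lt.le
      have hle := @Nat.cast_div_le ℝ _ _ _ n (k - 1)
      rw [Nat.cast_sub hp.one_lt.le] at hle
      gcongr
      rw [one_div_mul_eq_div]; exact_mod_cast hle
    · intro i hi
      obtain ⟨v, w, h, hc, hv⟩ := bn_fact_split k hp i
      have hd := bn_dvd_prod k w i n (Nat.isCoprime_iff_coprime.2 hc) ⟨k ^ v, by rw [h, mul_comm]⟩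
      rw [h, ← mul_assoc]
      push_cast
      refine mul_dvd_mul ?_ hd
      rw [← pow_add]
      apply pow_dvd_pow
      have : v ≤ n / (k - 1) := by
        rw [Nat.le_div_iff_mul_le (by omega), mul_comm]; omega
      omega

theorem bn_integral (k : ℕ) (hk : 3 ≤ k) (hk4 : k = 4 ∨ Nat.Prime k) (n : ℕ) :
    ∃ D : ℕ, 0 < D ∧ (D : ℝ) ≤ ((k : ℝ) * ∏ l ∈ k.primeFactors, (l : ℝ) ^ ((1 : ℝ) / ((l : ℝ) - 1))) ^ n ∧
      ∀ N : ℕ, (∃ z : ℤ, D * bnA (1 / k) n N = z) ∧ (∃ z : ℤ, D * bnB (1 / k) n N = z) := by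
  obtain ⟨D, h0, h1, h2⟩ := bn_denoms k hk hk4 n
  refine ⟨D, h0, h1, fun N => ?_⟩
  have key : ∀ j : ℕ, ∃ z : ℤ, D * bnC (1 / k) n j = z := by
    intro j
    obtain ⟨z, hz⟩ := h2 (n - j) (by omega)
    refine ⟨(n + j).choose n * z, ?_⟩
    unfold bnC
    have hk0 : (k : ℝ) ≠ 0 := by positivity
    have e : (k : ℝ) ^ (n - j) * ∏ l ∈ Finset.range (n - j), ((n : ℝ) - l - 1 / k) =
        ∏ l ∈ Finset.range (n - j), ((k : ℝ) * ((n : ℝ) - l) - 1) := by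
      have : (k : ℝ) ^ (n - j) = ∏ l ∈ Finset.range (n - j), (k : ℝ) := by simp
      rw [this, ← Finset.prod_mul_distrib]
      apply Finset.prod_congr rfl
      intro l _
      field_simp
    have hz' := congrArg (Int.cast : ℤ → ℝ) hz
    push_cast at hz' ⊢
    rw [← e] at hz'
    have f1 : ((n - j).factorial : ℝ) ≠ 0 := by positivity
    have f2 : (k : ℝ) ^ (n - j) ≠ 0 := by positivity
    have : (D : ℝ) * ∏ l ∈ Finset.range (n - j), ((n : ℝ) - l - 1 / k) = (n - j).factorial * z := by
      apply mul_left_cancel₀ f2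
      linear_combination hz'
    generalize (∏ l ∈ Finset.range (n - j), ((n : ℝ) - l - 1 / k)) = P at this ⊢
    field_simp
    linear_combination ((n + j).choose n : ℝ) * this
  choose z hz using key
  constructor
  · refine ⟨∑ j ∈ Finset.range (n + 1), z j * N ^ j, ?_⟩
    rw [bnA, Finset.mul_sum]
    push_cast
    refine Finset.sum_congr rfl fun j _ => ?_
    rw [← hz]; ring
  · refine ⟨∑ j ∈ Finset.range (n + 1), (-1) ^ (n + j) * (z j * (N + 1) ^ j), ?_⟩
    rw [bnB, Finset.mul_sum]
    push_cast
    refine Finset.sum_congr rfl fun j _ => ?_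
    rw [← hz]; ring

theorem bn_alpha (k : ℕ) (hk : 3 ≤ k) (x : ℝ) (hx : 1 ≤ x) (α : ℝ)
    (hα : α = (x + 1) ^ ((1 : ℝ) / k) * x ^ (-((1 : ℝ) / k))) :
    0 < α ∧ α ^ k * x = x + 1 ∧ α ≤ 1 + 1 / (k * x) := by
  have hx0 : 0 < x := by linarith
  have hk0 : (k : ℝ) ≠ 0 := by positivity
  have e : α = ((x + 1) / x) ^ ((1 : ℝ) / k) := by
    rw [hα, Real.rpow_neg hx0.le, Real.div_rpow (by linarith) hx0.le]; rfl
  have hp : 0 < α := by rw [e]; positivity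
  refine ⟨hp, ?_, ?_⟩
  · rw [e, ← Real.rpow_natCast, ← Real.rpow_mul (by positivity), one_div_mul_cancel hk0, Real.rpow_one]
    field_simp
  · rw [e]
    have h1 : (x + 1) / x = 1 + 1 / x := by field_simp
    have k1 : (1 : ℝ) ≤ k := by exact_mod_cast (by omega)
    have hx1 : (0 : ℝ) ≤ 1 / x := by positivity
    have := rpow_one_add_le_one_add_mul_self (s := 1 / x) (by linarith) (p := 1 / (k : ℝ))
      (by positivity) (by rw [div_le_one (by positivity)]; exact k1)
    rw [h1]
    refine this.trans (le_of_eq ?_)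
    field_simp

theorem bn_basic (k : ℕ) (hk : 3 ≤ k) (hk4 : k = 4 ∨ Nat.Prime k) (N : ℕ) (hN : 1 ≤ N) (p q : ℤ)
    (hq : 0 < q) (α κ Q δ : ℝ)
    (hα : α = ((N : ℝ) + 1) ^ ((1 : ℝ) / k) * (N : ℝ) ^ (-((1 : ℝ) / k)))
    (hκ : κ = (k : ℝ) * ∏ l ∈ k.primeFactors, (l : ℝ) ^ ((1 : ℝ) / ((l : ℝ) - 1)))
    (hQ : Q = (Real.sqrt N + Real.sqrt (N + 1)) ^ 2)
    (hδ : (p : ℝ) = q * (α + δ)) (hδ0 : 0 < δ) (n : ℕ) :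
    1 ≤ 2 * q / (k * N) * (κ ^ n / Q ^ n) + q * δ * (κ ^ n * Q ^ n) := by
  have hN1 : (1 : ℝ) ≤ N := by exact_mod_cast hN
  have hN0 : (0 : ℝ) < N := by linarith
  have hk0 : (0 : ℝ) < k := by positivity
  have hk3 : (3 : ℝ) ≤ k := by exact_mod_cast hk
  have hq0 : (0 : ℝ) < q := by exact_mod_cast hq
  have m0 : (0 : ℝ) < 1 / k := by positivity
  have m1 : (1 : ℝ) / k < 1 := by rw [div_lt_one hk0]; linarith
  obtain ⟨a0, a1, a2⟩ := bn_alpha k hk N hN1 α hα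
  have ha2 : α ≤ 2 := by
    have : 1 / ((k : ℝ) * N) ≤ 1 := by rw [div_le_one (by positivity)]; nlinarith
    linarith
  obtain ⟨D, hD0, hD1, hD⟩ := bn_integral k hk hk4 n
  obtain ⟨⟨za, hza⟩, ⟨zb, hzb⟩⟩ := hD N
  obtain ⟨r0, r1⟩ := bn_remainder (1 / k) N m0 m1 hN0 n
  obtain ⟨A0, A1⟩ := bnA_bounds (1 / k) N m0 m1 hN0 n
  rw [← hQ] at r1 A1
  rw [← hκ] at hD1
  have hQ0 : 0 < Q := by rw [hQ]; have := Real.sqrt_pos.2 hN0; positivity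
  have hx1 : 0 < ((N : ℝ) + 1) ^ ((1 : ℝ) / k) := by positivity
  set A := bnA (1 / k) n N
  set B := bnB (1 / k) n N
  have e : α * A - B = ((N : ℝ) + 1) ^ ((1 : ℝ) / k) *
      ((N : ℝ) ^ (-((1 : ℝ) / k)) * A - ((N : ℝ) + 1) ^ (-((1 : ℝ) / k)) * B) := by
    have : ((N : ℝ) + 1) ^ ((1 : ℝ) / k) * ((N : ℝ) + 1) ^ (-((1 : ℝ) / k)) = 1 := by
      rw [← Real.rpow_add (by positivity)]; simp
    rw [hα]
    linear_combination B * this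
  have s0 : 0 < α * A - B := by rw [e]; positivity
  have s1 : α * A - B ≤ 2 / (k * N) / Q ^ n := by
    rw [e]
    calc _ ≤ ((N : ℝ) + 1) ^ ((1 : ℝ) / k) * (1 / k * ((N : ℝ) ^ (-((1 : ℝ) / k) - 1) / Q ^ n)) := by
          gcongr
      _ = α / (k * N) / Q ^ n := by
          rw [hα, Real.rpow_sub hN0, Real.rpow_one]
          field_simp
      _ ≤ _ := by gcongr
  have hD0' : (0 : ℝ) < D := by exact_mod_cast hD0
  have hκn : 0 ≤ κ ^ n := hD0'.le.trans hD1
  have key : ((p * za - q * zb : ℤ) : ℝ) = D * (q * (α * A - B) + q * δ * A) := by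
    push_cast
    rw [← hza, ← hzb, hδ]
    ring
  have pos : 0 < ((p * za - q * zb : ℤ) : ℝ) := by rw [key]; positivity
  have one : (1 : ℝ) ≤ ((p * za - q * zb : ℤ) : ℝ) := by
    have : 0 < p * za - q * zb := by exact_mod_cast pos
    exact_mod_cast this
  rw [key] at one
  refine one.trans ?_
  calc (D : ℝ) * (q * (α * A - B) + q * δ * A)
      ≤ κ ^ n * (q * (2 / (k * N) / Q ^ n) + q * δ * Q ^ n) := by gcongr
    _ = _ := by ring

theorem bn_mu (k : ℕ) (hk : 3 ≤ k) (hk4 : k = 4 ∨ Nat.Prime k) (μ : ℝ)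
    (hμ : μ = ∏ l ∈ k.primeFactors, (l : ℝ) ^ ((1 : ℝ) / ((l : ℝ) - 1))) : 1 ≤ μ ∧ μ ≤ k := by
  rcases hk4 with rfl | hp
  · have : Nat.primeFactors 4 = {2} := by
      rw [show 4 = 2 ^ 2 by norm_num, Nat.primeFactors_prime_pow (by norm_num) Nat.prime_two]
    rw [hμ, this]; norm_num
  · rw [hμ, hp.primeFactors, Finset.prod_singleton]
    have k3 : (3 : ℝ) ≤ k := by exact_mod_cast hk
    have h0 : (0 : ℝ) ≤ 1 / ((k : ℝ) - 1) := by apply div_nonneg <;> linarith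
    have h1 : 1 / ((k : ℝ) - 1) ≤ 1 := by rw [div_le_one (by linarith)]; linarith
    constructor
    · exact Real.one_le_rpow (by linarith) h0
    · calc _ ≤ (k : ℝ) ^ (1 : ℝ) := Real.rpow_le_rpow_of_exponent_le (by linarith) h1
        _ = k := Real.rpow_one _

/-- The effective irrationality measure. -/
theorem bn_bennett (k : ℝ) (N q κ Q δ lam : ℝ) (hk : 3 ≤ k) (hN : 4 ≤ N) (hq : 1 ≤ q) (hκ : 1 ≤ κ)
    (hQ1 : Q ≤ 4 * N + 2) (hQκ : κ < Q)
    (hlam : lam = 1 + Real.log (κ * Q) / Real.log (1 / κ * Q)) (hδ : 0 < δ)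
    (h : ∀ n : ℕ, 1 ≤ 2 * q / (k * N) * (κ ^ n / Q ^ n) + q * δ * (κ ^ n * Q ^ n)) :
    1 ≤ δ * (8 * κ * N) * q ^ lam := by
  have hκ0 : 0 < κ := by linarith
  have hQ0 : 0 < Q := by linarith
  set Y := 1 / κ * Q with hY
  have hY1 : 1 < Y := by rw [hY, one_div_mul_eq_div, lt_div_iff₀ hκ0]; linarith
  have hlog : 0 < Real.log Y := Real.log_pos hY1
  have hYle : Y ≤ κ * Q := by
    rw [hY]; gcongr
    rw [div_le_iff₀ hκ0]; nlinarith
  have hlam1 : 1 ≤ lam - 1 := by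
    rw [hlam, add_sub_cancel_left, le_div_iff₀ hlog, one_mul]
    exact Real.log_le_log (by linarith) hYle
  have hpow : Y ^ (lam - 1) = κ * Q := by
    rw [hlam, add_sub_cancel_left, Real.rpow_def_of_pos (by linarith), mul_div_cancel₀ _ hlog.ne',
      Real.exp_log (by positivity)]
  have hkN : 12 ≤ k * N := by nlinarith
  have hex : ∃ n : ℕ, 4 * q / (k * N) ≤ Y ^ n := by
    obtain ⟨n, hn⟩ := pow_unbounded_of_one_lt (4 * q / (k * N)) hY1
    exact ⟨n, hn.le⟩
  classical
  have hspec := Nat.find_spec hex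
  set n := Nat.find hex with hn
  have hhalf : 1 / 2 ≤ q * δ * (κ ^ n * Q ^ n) := by
    have h1 := h n
    have : 2 * q / (k * N) * (κ ^ n / Q ^ n) ≤ 1 / 2 := by
      have e : κ ^ n / Q ^ n = 1 / Y ^ n := by
        rw [hY, mul_pow, div_pow, one_pow]; field_simp
      rw [e, mul_one_div, div_le_iff₀ (by positivity)]
      have : 2 * q / (k * N) = 4 * q / (k * N) / 2 := by ring
      linarith
    linarith
  have hqlam : q ^ lam = q * q ^ (lam - 1) := by
    rw [Real.rpow_sub_one (by linarith)]; field_simp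
  have hq1 : 1 ≤ q ^ (lam - 1) := Real.one_le_rpow hq (by linarith)
  rw [hqlam]
  rcases Nat.eq_zero_or_pos n with h0 | hpos
  · rw [h0] at hhalf
    simp only [pow_zero, mul_one] at hhalf
    have : 4 ≤ κ * N := by nlinarith
    calc (1 : ℝ) ≤ (1 / 2) * (8 * 4) * 1 := by norm_num
      _ ≤ (q * δ) * (8 * (κ * N)) * q ^ (lam - 1) := by gcongr
      _ = _ := by ring
  · obtain ⟨n', hn'⟩ : ∃ n', n = n' + 1 := ⟨n - 1, by omega⟩
    have hlt : Y ^ n' < 4 * q / (k * N) := by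
      have := Nat.find_min hex (m := n') (by omega)
      exact not_le.1 this
    have hb : (κ * Q) ^ n' ≤ q ^ (lam - 1) / 2 := by
      calc (κ * Q) ^ n' = (Y ^ n') ^ (lam - 1) := by
            rw [← hpow, ← Real.rpow_natCast, ← Real.rpow_natCast, ← Real.rpow_mul (by linarith),
              ← Real.rpow_mul (by linarith), mul_comm]
        _ ≤ (4 * q / (k * N)) ^ (lam - 1) := by
            apply Real.rpow_le_rpow (by positivity) hlt.le (by linarith)
        _ = (4 / (k * N)) ^ (lam - 1) * q ^ (lam - 1) := by
            rw [← Real.mul_rpow (by positivity) (by linarith)]; congr 1; ring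
        _ ≤ (4 / (k * N)) ^ (1 : ℝ) * q ^ (lam - 1) := by
            apply mul_le_mul_of_nonneg_right _ (by positivity)
            apply Real.rpow_le_rpow_of_exponent_ge (by positivity) _ hlam1
            rw [div_le_one (by positivity)]; linarith
        _ ≤ 1 / 2 * q ^ (lam - 1) := by
            rw [Real.rpow_one]
            apply mul_le_mul_of_nonneg_right _ (by positivity)
            rw [div_le_div_iff₀ (by positivity) (by positivity)]; linarith
        _ = _ := by ring
    rw [hn', ← mul_pow, pow_succ] at hhalf
    have h2 : 1 / 2 ≤ q * δ * (q ^ (lam - 1) / 2 * (κ * (4 * N + 2))) := hhalf.trans (by gcongr)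
    have h3 : q * δ * (q ^ (lam - 1) / 2 * (κ * (4 * N + 2))) ≤ q * δ * (q ^ (lam - 1) / 2 * (κ * (8 * N))) := by
      gcongr; linarith
    nlinarith

theorem bn_Q (N : ℝ) (hN : 0 ≤ N) :
    4 * N ≤ (Real.sqrt N + Real.sqrt (N + 1)) ^ 2 ∧
    (Real.sqrt N + Real.sqrt (N + 1)) ^ 2 ≤ 4 * N + 2 := by
  have hu := Real.sq_sqrt hN
  have hv := Real.sq_sqrt (show (0 : ℝ) ≤ N + 1 by linarith)
  have pu := Real.sqrt_nonneg N
  have pv := Real.sqrt_nonneg (N + 1)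
  have huv : Real.sqrt N ≤ Real.sqrt (N + 1) := Real.sqrt_le_sqrt (by linarith)
  constructor
  · nlinarith
  · nlinarith [sq_nonneg (Real.sqrt N - Real.sqrt (N + 1))]

set_option maxHeartbeats 2000000 in
/-- For `k = 4` or `k` prime, and a `k`-th power Diophantine triple `{a^k, b, c}`,
with `N := a^k b`, `μ_k` and `λ` as in Bennett's theorem, one has
`(a² t)^{k-λ} < 8 μ_k (a^k b)²`. -/
theorem a_sq_t_rpow_upper_bound
    (k : ℕ) (a b c r s t : ℤ) (hk : 3 ≤ k) (hk4 : k = 4 ∨ Nat.Prime k)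
    (ha : 1 < a) (hab : a < b) (hbc : b < c) (hakb : a ^ k < b)
    (hr : 0 < r) (hs : 0 < s) (ht : 0 < t)
    (h1 : a ^ k * b + 1 = r ^ k) (h2 : a ^ k * c + 1 = s ^ k)
    (h3 : b * c + 1 = t ^ k)
    (N μ lam : ℝ) (hN : N = (a : ℝ) ^ k * b)
    (hμ : μ = ∏ l ∈ k.primeFactors, (l : ℝ) ^ ((1 : ℝ) / ((l : ℝ) - 1)))
    (hlam : lam = 1 + Real.log ((k : ℝ) * μ * (Real.sqrt N + Real.sqrt (N + 1)) ^ 2) /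
      Real.log ((1 / ((k : ℝ) * μ)) * (Real.sqrt N + Real.sqrt (N + 1)) ^ 2)) :
    ((a : ℝ) ^ 2 * t) ^ ((k : ℝ) - lam) < 8 * μ * ((a : ℝ) ^ k * b) ^ 2 := by
  have hk0 : (0 : ℝ) < k := by positivity
  have hk3 : (3 : ℝ) ≤ k := by exact_mod_cast hk
  have hak : 0 < a ^ k := by positivity
  have hb : 0 < b := by linarith
  have hNz : 0 < a ^ k * b := by positivity
  have hkk : (k : ℤ) * k < a ^ k * a ^ k := by
    have h2 : (2 : ℤ) ^ k ≤ a ^ k := pow_le_pow_left₀ (by norm_num) (by linarith) k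
    have h3 : (k : ℤ) < 2 ^ k := by exact_mod_cast Nat.lt_two_pow_self
    have h4 : (k : ℤ) < a ^ k := by linarith
    exact mul_lt_mul'' h4 h4 (by positivity) (by positivity)
  have hN2 : a ^ k * a ^ k < a ^ k * b := by gcongr
  obtain ⟨M, hM⟩ : ∃ M : ℕ, (M : ℤ) = a ^ k * b := ⟨(a ^ k * b).toNat, Int.toNat_of_nonneg hNz.le⟩
  have hMN : (M : ℝ) = N := by
    rw [hN]; exact_mod_cast congrArg (Int.cast : ℤ → ℝ) hM
  have hkk' : (k : ℝ) * k < (a : ℝ) ^ k * a ^ k := by exact_mod_cast hkk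
  have hN2' : (a : ℝ) ^ k * a ^ k < N := by rw [hN]; exact_mod_cast hN2
  have hN9 : 9 ≤ N := by nlinarith
  have hM1 : 1 ≤ M := by
    have : (1 : ℝ) ≤ M := by rw [hMN]; linarith
    exact_mod_cast this
  set α : ℝ := (N + 1) ^ ((1 : ℝ) / k) * N ^ (-((1 : ℝ) / k)) with hα
  clear_value α
  obtain ⟨a0, a1, a2⟩ := bn_alpha k hk N (by linarith) α hα
  obtain ⟨μ1, μ2⟩ := bn_mu k hk hk4 μ hμ
  obtain ⟨Q1, Q2⟩ := bn_Q N (by linarith)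
  have hqz : 0 < a ^ 2 * t := by positivity
  set q : ℝ := (a : ℝ) ^ 2 * t with hq
  clear_value q
  have hq1 : 1 ≤ q := by
    have : (1 : ℤ) ≤ a ^ 2 * t := hqz
    rw [hq]; exact_mod_cast this
  have hq0 : 0 < q := by linarith
  set E : ℝ := N - (a : ℝ) ^ k * a ^ k with hE
  clear_value E
  have hE0 : 0 < E := by rw [hE]; linarith
  -- the fundamental identity
  have h1' : N + 1 = (r : ℝ) ^ k := by rw [hN]; exact_mod_cast h1
  have h2' : (a : ℝ) ^ k * c + 1 = (s : ℝ) ^ k := by exact_mod_cast h2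
  have h3' : (b : ℝ) * c + 1 = (t : ℝ) ^ k := by exact_mod_cast h3
  have hs1 : N * (s : ℝ) ^ k = q ^ k + E := by
    rw [hE, hq, mul_pow, ← h3', ← h2', hN, ← pow_mul, mul_comm 2 k, pow_mul]; ring
  have hpk : ((r : ℝ) * s) ^ k = α ^ k * (q ^ k + E) := by
    rw [mul_pow, ← h1', ← hs1, ← a1]; ring
  have hp0 : (0 : ℝ) < (r : ℝ) * s := by
    have h1 : (0 : ℝ) < r := by exact_mod_cast hr
    have h2 : (0 : ℝ) < s := by exact_mod_cast hs
    positivity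
  have hlow : α * q < r * s := by
    apply lt_of_pow_lt_pow_left₀ k hp0.le
    rw [hpk, mul_pow]
    gcongr
    linarith
  have hup : (r : ℝ) * s ≤ α * q * (1 + E / (k * q ^ k)) := by
    apply le_of_pow_le_pow_left₀ (n := k) (by omega) (by positivity)
    rw [hpk, mul_pow, mul_pow, mul_assoc]
    apply mul_le_mul_of_nonneg_left _ (by positivity)
    have hB := one_add_mul_le_pow (a := E / (k * q ^ k)) (by
      have : 0 ≤ E / (k * q ^ k) := by positivity
      linarith) k
    calc q ^ k + E = q ^ k * (1 + k * (E / (k * q ^ k))) := by field_simp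
      _ ≤ _ := by gcongr
  set δ : ℝ := r * s / q - α with hδ
  clear_value δ
  have hδ0 : 0 < δ := by
    rw [hδ, sub_pos, lt_div_iff₀ hq0]; exact hlow
  have hδ1 : δ ≤ α * E / (k * q ^ k) := by
    rw [hδ, sub_le_iff_le_add, div_le_iff₀ hq0]
    refine hup.trans (le_of_eq ?_)
    ring
  have hαE : α * E < N := by
    have i1 : α * E ≤ (1 + 1 / (k * N)) * E := by gcongr
    have i2 : 1 / (k * N) * E ≤ 1 := by
      rw [one_div_mul_eq_div, div_le_one (by positivity)]
      have g1 : 0 ≤ (a : ℝ) ^ k * a ^ k := mul_self_nonneg _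
      have g2 : N ≤ k * N := le_mul_of_one_le_left (by linarith) (by linarith)
      linarith
    have i3 : E < N - 1 := by
      have : (1 : ℝ) ≤ k * k := by nlinarith
      linarith
    linarith
  have hmain := bn_bennett k N q (k * μ) _ δ lam hk3 (by linarith) hq1 (by nlinarith) Q2
    (by
      have : (k : ℝ) * μ ≤ k * k := by gcongr
      linarith) hlam hδ0 (by
      intro n
      have := bn_basic k hk hk4 M hM1 (r * s) (a ^ 2 * t) hqz α (k * μ)
        ((Real.sqrt N + Real.sqrt (N + 1)) ^ 2) δ (by rw [hMN]; exact hα) (by rw [hμ]) (by rw [hMN]) (by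
          push_cast
          rw [← hq, hδ]; field_simp; ring) hδ0 n
      push_cast at this
      rw [← hq, hMN] at this
      exact this)
  rw [← hN, Real.rpow_sub hq0, Real.rpow_natCast, div_lt_iff₀ (by positivity)]
  have hL : 0 < q ^ lam := by positivity
  have hfin : δ * (8 * (k * μ) * N) * q ^ lam < 8 * μ * N ^ 2 * q ^ lam / q ^ k := by
    calc δ * (8 * (k * μ) * N) * q ^ lam
        ≤ α * E / (k * q ^ k) * (8 * (k * μ) * N) * q ^ lam := by gcongr
      _ = α * E * (8 * μ * N * q ^ lam / q ^ k) := by field_simp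
      _ < N * (8 * μ * N * q ^ lam / q ^ k) := by
          apply mul_lt_mul_of_pos_right hαE; positivity
      _ = _ := by ring
  have := lt_of_le_of_lt hmain hfin
  rw [lt_div_iff₀ (by positivity), one_mul] at this
  exact this
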